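/- Let X be a real-valued random variable on a probability space with |X| ≤ Q_m almost surely for some constant Q_m ≥ 0, and with standard deviation σ = √(Var[X]) > 0. Let β > 0 and K > 0 be constants with β ≤ σ. Then E[(β/σ)·|X − E[X]|] ≤ (1 − 1/K²)·β·K + (2/K²)·Q_m. -/

import Mathlib

open MeasureTheory ProbabilityTheory

/-- The mean absolute deviation is at most the standard deviation. -/
lemma integral_abs_sub_integral_le_sqrt_variance
    {Ω : Type*} [MeasurableSpace Ω] {μ : Measure Ω} [IsProbabilityMeasure μ]
    {X : Ω → ℝ} (hX : MemLp X 2 μ) :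
    ∫ ω, |X ω - ∫ x, X x ∂μ| ∂μ ≤ Real.sqrt (variance X μ) := by
  have hY : MemLp (fun ω => |X ω - ∫ x, X x ∂μ|) 2 μ := (hX.sub (memLp_const _)).abs
  apply Real.le_sqrt_of_sq_le
  have h := variance_nonneg (fun ω => |X ω - ∫ x, X x ∂μ|) μ
  rw [variance_eq_sub hY] at h
  rw [variance_eq_integral hX.aestronglyMeasurable.aemeasurable]
  simpa [sq_abs] using h

/-- Central quantitative bound in Theorem A.2 of UWAC: for a random variable `X` bounded
a.s. by `Q_m` with standard deviation `σ = √Var[X] > 0`, and constants `0 < β ≤ σ`,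
`K > 0`, the expected uncertainty-weighted deviation satisfies
`E[(β/σ) * |X - E[X]|] ≤ (1 - 1/K²) * β * K + (2/K²) * Q_m`. -/
theorem weighted_deviation_expectation_bound
    {Ω : Type*} [MeasurableSpace Ω] (μ : Measure Ω) [IsProbabilityMeasure μ]
    (X : Ω → ℝ) (hmeas : Measurable X)
    (Qm : ℝ) (hQm : 0 ≤ Qm) (hbound : ∀ᵐ ω ∂μ, |X ω| ≤ Qm)
    (σ : ℝ) (hσ : σ = Real.sqrt (variance X μ)) (hσpos : 0 < σ)
    (β K : ℝ) (hβ : 0 < β) (hK : 0 < K) (hβσ : β ≤ σ) :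
    ∫ ω, (β / σ) * |X ω - ∫ x, X x ∂μ| ∂μ
      ≤ (1 - 1 / K ^ 2) * β * K + (2 / K ^ 2) * Qm := by
  have hIcc : ∀ᵐ ω ∂μ, X ω ∈ Set.Icc (-Qm) Qm := hbound.mono fun ω h => abs_le.mp h
  have hX : MemLp X 2 μ := memLp_of_bounded hIcc hmeas.aestronglyMeasurable 2
  have hσQ : σ ≤ Qm := by
    rw [hσ]
    apply Real.sqrt_le_iff.mpr ⟨hQm, ?_⟩
    convert variance_le_sq_of_bounded hIcc hmeas.aemeasurable using 1
    ring
  have hdev : ∫ ω, |X ω - ∫ x, X x ∂μ| ∂μ ≤ σ :=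
    hσ ▸ integral_abs_sub_integral_le_sqrt_variance hX
  rw [integral_const_mul]
  calc (β / σ) * ∫ ω, |X ω - ∫ x, X x ∂μ| ∂μ ≤ (β / σ) * σ := by gcongr
    _ = β := div_mul_cancel₀ β hσpos.ne'
    _ ≤ (1 - 1 / K ^ 2) * β * K + (2 / K ^ 2) * β := by
      have h : (1 - 1 / K ^ 2) * β * K + (2 / K ^ 2) * β - β
          = β * ((K - 1) ^ 2 * (K + 1) + 1) / K ^ 2 := by
        field_simp
        ring
      have h_nonneg : 0 ≤ β * ((K - 1) ^ 2 * (K + 1) + 1) / K ^ 2 := by positivity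
      linarith
    _ ≤ (1 - 1 / K ^ 2) * β * K + (2 / K ^ 2) * Qm := by
      gcongr
      exact hβσ.trans hσQ
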